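/- Let H ∈ (0,1) and define the fractional Gaussian noise autocovariance ρ(k) = (1/2)((k+1)^{2H} + |k−1|^{2H} − 2 k^{2H}) for integers k ≥ 0. Then for all positive integers p, q: ∑_{i=1}^p ∑_{j=1}^q ρ(|i−j|) − ∑_{i=1}^p ∑_{j=1}^q ρ(i+j−1) = p^{2H} + q^{2H} − (1/2)(|p−q|^{2H} + (p+q)^{2H}). Consequently, the lattice process S_n = (1/√2)(B_n^H + B_{−n}^H) constructed from a two-sided fractional Gaussian random walk satisfies E[S_p S_q] = R_H(p,q). -/

import Mathlib

open Real Finset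

/-- Autocovariance of fractional Gaussian noise with Hurst index `H`,
evaluated at a real lag `x ≥ 0`. -/
noncomputable def fgnCov (H x : ℝ) : ℝ :=
  (1 / 2) * ((x + 1) ^ (2 * H) + |x - 1| ^ (2 * H) - 2 * x ^ (2 * H))

theorem fgnCov_abs (H x : ℝ) :
    fgnCov H |x| =
      (1 / 2) * (|x + 1| ^ (2 * H) + |x - 1| ^ (2 * H) - 2 * |x| ^ (2 * H)) := by
  unfold fgnCov
  rcases le_total 0 x with hx | hx
  · rw [abs_of_nonneg hx, abs_of_nonneg (by linarith : 0 ≤ x + 1)]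
  · rw [abs_of_nonpos hx, abs_of_nonpos (by linarith : x - 1 ≤ 0),
      show -x + 1 = -(x - 1) by ring, show -x - 1 = -(x + 1) by ring, abs_neg]
    ring

/-- A second difference of `f` in the lag `i - j` telescopes over a rectangle. -/
theorem sum_second_difference_sub (f : ℝ → ℝ) (p q : ℕ) :
    ∑ i ∈ Finset.Icc 1 p, ∑ j ∈ Finset.Icc 1 q,
      (f ((i : ℝ) - j + 1) + f ((i : ℝ) - j - 1) - 2 * f ((i : ℝ) - j))
    = f p + f (-q) - f 0 - f ((p : ℝ) - q) := by
  have inner (x : ℝ) : ∑ j ∈ Finset.Icc 1 q, (f (x - j + 1) + f (x - j - 1) - 2 * f (x - j))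
      = f x - f (x - 1) - (f (x - q) - f (x - q - 1)) := by
    induction q with
    | zero => simp
    | succ n ih =>
      rw [Finset.sum_Icc_succ_top (by omega), ih]
      push_cast
      rw [show x - (n + 1 : ℝ) + 1 = x - n by ring, show x - (n + 1 : ℝ) = x - n - 1 by ring]
      ring
  simp only [inner]
  induction p with
  | zero => simp
  | succ n ih =>
    rw [Finset.sum_Icc_succ_top (by omega), ih]
    push_cast
    rw [show (n + 1 : ℝ) - 1 = n by ring, show (n + 1 : ℝ) - q - 1 = n - q by ring]
    ring

/-- A second difference of `f` in the lag `i + j - 1` telescopes over a rectangle. -/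
theorem sum_second_difference_add (f : ℝ → ℝ) (p q : ℕ) :
    ∑ i ∈ Finset.Icc 1 p, ∑ j ∈ Finset.Icc 1 q,
      (f ((i : ℝ) + j - 1 + 1) + f ((i : ℝ) + j - 1 - 1) - 2 * f ((i : ℝ) + j - 1))
    = f ((p : ℝ) + q) + f 0 - f p - f q := by
  have inner (x : ℝ) : ∑ j ∈ Finset.Icc 1 q,
      (f (x + j - 1 + 1) + f (x + j - 1 - 1) - 2 * f (x + j - 1))
      = f (x + q) - f (x + q - 1) - (f x - f (x - 1)) := by
    induction q with
    | zero => simp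
    | succ n ih =>
      rw [Finset.sum_Icc_succ_top (by omega), ih]
      push_cast
      rw [show x + (n + 1 : ℝ) - 1 = x + n by ring, show x + (n + 1 : ℝ) = x + n + 1 by ring]
      ring
  simp only [inner]
  induction p with
  | zero => simp
  | succ n ih =>
    rw [Finset.sum_Icc_succ_top (by omega), ih]
    push_cast
    rw [show (n + 1 : ℝ) + q - 1 = n + q by ring, show (n + 1 : ℝ) - 1 = n by ring]
    ring

theorem lattice_sfbm_covariance (H : ℝ) (hH : H ∈ Set.Ioo (0 : ℝ) 1)
    (p q : ℕ) (hp : 0 < p) (hq : 0 < q) :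
    (∑ i ∈ Finset.Icc 1 p, ∑ j ∈ Finset.Icc 1 q, fgnCov H |(i : ℝ) - (j : ℝ)|)
      - (∑ i ∈ Finset.Icc 1 p, ∑ j ∈ Finset.Icc 1 q, fgnCov H ((i : ℝ) + (j : ℝ) - 1))
    = (p : ℝ) ^ (2 * H) + (q : ℝ) ^ (2 * H)
      - (1 / 2) * (|(p : ℝ) - (q : ℝ)| ^ (2 * H) + ((p : ℝ) + (q : ℝ)) ^ (2 * H)) := by
  have hzero : |(0 : ℝ)| ^ (2 * H) = 0 := by
    rw [abs_zero, Real.zero_rpow (by linarith [hH.1])]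
  have hsum : ∑ i ∈ Finset.Icc 1 p, ∑ j ∈ Finset.Icc 1 q, fgnCov H ((i : ℝ) + (j : ℝ) - 1)
      = ∑ i ∈ Finset.Icc 1 p, ∑ j ∈ Finset.Icc 1 q, fgnCov H |(i : ℝ) + (j : ℝ) - 1| := by
    refine Finset.sum_congr rfl fun i hi => Finset.sum_congr rfl fun j _ => ?_
    have hi' : (1 : ℝ) ≤ i := by exact_mod_cast (Finset.mem_Icc.mp hi).1
    have hj' : (0 : ℝ) ≤ j := j.cast_nonneg
    rw [abs_of_nonneg (by linarith : (0 : ℝ) ≤ (i : ℝ) + j - 1)]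
  rw [hsum]
  simp only [fgnCov_abs, ← Finset.mul_sum]
  rw [sum_second_difference_sub (fun x => |x| ^ (2 * H)),
    sum_second_difference_add (fun x => |x| ^ (2 * H))]
  simp only [hzero, abs_neg, Nat.abs_cast]
  rw [abs_of_nonneg (by positivity : (0 : ℝ) ≤ (p : ℝ) + q)]
  ring
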